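/- For a heptagon with vertices p_0, …, p_6 in clockwise convex position: if every standardization line ℓ_i (i ∈ ℤ/7ℤ) is +-crossing or −-crossing, then either all seven are +-crossing or all seven are −-crossing. -/

import Mathlib

open Matrix

/-- Homogeneous coordinates of a point in the plane. -/
noncomputable def hat (p : Fin 2 → ℝ) : Fin 3 → ℝ := ![p 0, p 1, 1]

/-- Determinant of the 3×3 matrix with rows `u`, `v`, `w`. -/
def det3 (u v w : Fin 3 → ℝ) : ℝ := Matrix.det (Matrix.of ![u, v, w])

/-- The standardization point `p_i⁺`. -/
noncomputable def pplus (p : Fin 7 → Fin 2 → ℝ) (i : Fin 7) : Fin 3 → ℝ :=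
  crossProduct (crossProduct (hat (p (i + 1))) (hat (p (i + 2))))
    (crossProduct (hat (p i)) (hat (p (i + 3))))

/-- The standardization point `p_i⁻`. -/
noncomputable def pminus (p : Fin 7 → Fin 2 → ℝ) (i : Fin 7) : Fin 3 → ℝ :=
  crossProduct (crossProduct (hat (p (i - 1))) (hat (p (i - 2))))
    (crossProduct (hat (p i)) (hat (p (i - 3))))

/-- The `i`-th standardization line `ℓ_i` (in homogeneous line coordinates). -/
noncomputable def sline (p : Fin 7 → Fin 2 → ℝ) (i : Fin 7) : Fin 3 → ℝ :=
  crossProduct (pplus p i) (pminus p i)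

/-- The line `ℓ_i` is `+`-crossing: it separates `p_{i+1}` and `p_{i+2}` from the
remaining vertices of the heptagon. -/
noncomputable def IsPlusCrossing (p : Fin 7 → Fin 2 → ℝ) (i : Fin 7) : Prop :=
  ∃ ε : ℝ, (ε = 1 ∨ ε = -1) ∧
    0 ≤ ε * (sline p i ⬝ᵥ hat (p (i + 1))) ∧
    0 ≤ ε * (sline p i ⬝ᵥ hat (p (i + 2))) ∧
    ∀ j : Fin 7, j ≠ i + 1 → j ≠ i + 2 → ε * (sline p i ⬝ᵥ hat (p j)) < 0

/-- The line `ℓ_i` is `−`-crossing: it separates `p_{i−1}` and `p_{i−2}` from the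
remaining vertices of the heptagon. -/
noncomputable def IsMinusCrossing (p : Fin 7 → Fin 2 → ℝ) (i : Fin 7) : Prop :=
  ∃ ε : ℝ, (ε = 1 ∨ ε = -1) ∧
    0 ≤ ε * (sline p i ⬝ᵥ hat (p (i - 1))) ∧
    0 ≤ ε * (sline p i ⬝ᵥ hat (p (i - 2))) ∧
    ∀ j : Fin 7, j ≠ i - 1 → j ≠ i - 2 → ε * (sline p i ⬝ᵥ hat (p j)) < 0

/-- The determinant `det3` written out in coordinates. -/
theorem det3_eq (u v w : Fin 3 → ℝ) :
    det3 u v w = u 0 * v 1 * w 2 - u 0 * v 2 * w 1 - u 1 * v 0 * w 2 + u 1 * v 2 * w 0 +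
      u 2 * v 0 * w 1 - u 2 * v 1 * w 0 := by
  simp [det3, Matrix.det_fin_three]

theorem det3_rotate (u v w : Fin 3 → ℝ) : det3 v w u = det3 u v w := by
  simp only [det3_eq]
  ring

theorem crossProduct_dotProduct_eq_det3 (u v w : Fin 3 → ℝ) :
    crossProduct u v ⬝ᵥ w = det3 u v w := by
  simp only [det3_eq, cross_apply, vec3_dotProduct, cons_val]
  ring

theorem crossProduct_crossProduct_eq_left (a b c d : Fin 3 → ℝ) :
    crossProduct (crossProduct a b) (crossProduct c d) =
      det3 a c d • b - det3 b c d • a := by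
  ext j
  fin_cases j <;> simp [det3_eq, cross_apply] <;> ring

theorem crossProduct_crossProduct_eq_right (a b c d : Fin 3 → ℝ) :
    crossProduct (crossProduct a b) (crossProduct c d) =
      det3 a b d • c - det3 a b c • d := by
  ext j
  fin_cases j <;> simp [det3_eq, cross_apply] <;> ring

theorem det3_smul_sub_smul (s t x y : ℝ) (a b c d w : Fin 3 → ℝ) :
    det3 (s • a - t • b) (x • c - y • d) w =
      s * x * det3 a c w - s * y * det3 a d w - t * x * det3 b c w + t * y * det3 b d w := by
  simp only [det3_eq, Pi.sub_apply, Pi.smul_apply, smul_eq_mul]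
  ring

/-- A three-term Grassmann–Plücker relation. -/
theorem det3_plucker (a b c d e : Fin 3 → ℝ) :
    det3 b d e * det3 a c d =
      det3 a d e * det3 b c d + det3 c d e * det3 a b d := by
  simp only [det3_eq]
  ring

/-- The line `ℓ_i`, as a function of the vertices `p_i, p_{i+1}, …, p_{i+6}`. -/
theorem sline_eq (p : Fin 7 → Fin 2 → ℝ) (i : Fin 7) :
    sline p i = crossProduct
      (crossProduct (crossProduct (hat (p (i + 1))) (hat (p (i + 2))))
        (crossProduct (hat (p i)) (hat (p (i + 3)))))
      (crossProduct (crossProduct (hat (p (i + 6))) (hat (p (i + 5))))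
        (crossProduct (hat (p i)) (hat (p (i + 4))))) := by
  have h1 : i - 1 = i + 6 := by revert i; decide
  have h2 : i - 2 = i + 5 := by revert i; decide
  have h3 : i - 3 = i + 4 := by revert i; decide
  rw [sline, pplus, pminus, h1, h2, h3]

theorem sline_dotProduct_hat_self (p : Fin 7 → Fin 2 → ℝ) (i : Fin 7) :
    sline p i ⬝ᵥ hat (p i) =
      -(det3 (hat (p i)) (hat (p (i + 1))) (hat (p (i + 2))) *
        det3 (hat (p i)) (hat (p (i + 5))) (hat (p (i + 6))) *
        det3 (hat (p i)) (hat (p (i + 3))) (hat (p (i + 4)))) := by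
  rw [sline_eq, crossProduct_dotProduct_eq_det3, crossProduct_crossProduct_eq_right,
    crossProduct_crossProduct_eq_right, det3_smul_sub_smul]
  simp only [det3_eq]
  ring

theorem sline_dotProduct_hat_add_one (p : Fin 7 → Fin 2 → ℝ) (i : Fin 7) :
    sline p i ⬝ᵥ hat (p (i + 1)) =
      det3 (hat (p i)) (hat (p (i + 1))) (hat (p (i + 3))) *
        (det3 (hat (p (i + 4))) (hat (p (i + 5))) (hat (p (i + 6))) *
            det3 (hat (p i)) (hat (p (i + 1))) (hat (p (i + 2))) -
          det3 (hat (p i)) (hat (p (i + 5))) (hat (p (i + 6))) *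
            det3 (hat (p (i + 1))) (hat (p (i + 2))) (hat (p (i + 4)))) := by
  rw [sline_eq, crossProduct_dotProduct_eq_det3, crossProduct_crossProduct_eq_left,
    crossProduct_crossProduct_eq_right, det3_smul_sub_smul]
  simp only [det3_eq]
  ring

theorem sline_dotProduct_hat_add_six (p : Fin 7 → Fin 2 → ℝ) (i : Fin 7) :
    sline p i ⬝ᵥ hat (p (i + 6)) =
      det3 (hat (p i)) (hat (p (i + 4))) (hat (p (i + 6))) *
        (det3 (hat (p (i + 1))) (hat (p (i + 2))) (hat (p (i + 3))) *
            det3 (hat (p i)) (hat (p (i + 5))) (hat (p (i + 6))) -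
          det3 (hat (p i)) (hat (p (i + 1))) (hat (p (i + 2))) *
            det3 (hat (p (i + 3))) (hat (p (i + 5))) (hat (p (i + 6)))) := by
  rw [sline_eq, crossProduct_dotProduct_eq_det3, crossProduct_crossProduct_eq_right,
    crossProduct_crossProduct_eq_left, det3_smul_sub_smul]
  simp only [det3_eq]
  ring

/-- Convexity of the heptagon, with the vertices numbered starting from `p i`. -/
theorem det3_hat_add_neg {p : Fin 7 → Fin 2 → ℝ}
    (hconv : ∀ i j k : Fin 7, i < j → j < k →
      det3 (hat (p i)) (hat (p j)) (hat (p k)) < 0)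
    (i a b c : Fin 7) (hab : a < b) (hbc : b < c) :
    det3 (hat (p (i + a))) (hat (p (i + b))) (hat (p (i + c))) < 0 := by
  have key : (i + a < i + b ∧ i + b < i + c) ∨ (i + b < i + c ∧ i + c < i + a) ∨
      (i + c < i + a ∧ i + a < i + b) := by
    simp only [Fin.lt_def, Fin.val_add] at *
    omega
  obtain h | h | h := key
  · exact hconv _ _ _ h.1 h.2
  · rw [← det3_rotate]
    exact hconv _ _ _ h.1 h.2
  · rw [← det3_rotate, ← det3_rotate]
    exact hconv _ _ _ h.1 h.2

/-- The vertex `p_i` always lies on the positive side of `ℓ_i`. -/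
theorem sline_dotProduct_hat_self_pos {p : Fin 7 → Fin 2 → ℝ}
    (hconv : ∀ i j k : Fin 7, i < j → j < k →
      det3 (hat (p i)) (hat (p j)) (hat (p k)) < 0) (i : Fin 7) :
    0 < sline p i ⬝ᵥ hat (p i) := by
  have h := fun a b => det3_hat_add_neg hconv i 0 a b
  simp only [add_zero] at h
  rw [sline_dotProduct_hat_self, neg_pos]
  exact mul_neg_of_pos_of_neg (mul_pos_of_neg_of_neg (h 1 2 (by decide) (by decide))
    (h 5 6 (by decide) (by decide))) (h 3 4 (by decide) (by decide))

theorem IsPlusCrossing.sline_dotProduct_hat_add_one_nonpos {p : Fin 7 → Fin 2 → ℝ}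
    (hconv : ∀ i j k : Fin 7, i < j → j < k →
      det3 (hat (p i)) (hat (p j)) (hat (p k)) < 0) {i : Fin 7} (h : IsPlusCrossing p i) :
    sline p i ⬝ᵥ hat (p (i + 1)) ≤ 0 := by
  obtain ⟨ε, hε, h1, -, h0⟩ := h
  have hpos := sline_dotProduct_hat_self_pos hconv i
  have hneg := h0 i (by simp) (by simp)
  obtain rfl | rfl := hε <;> linarith

theorem IsMinusCrossing.sline_dotProduct_hat_add_six_nonpos {p : Fin 7 → Fin 2 → ℝ}
    (hconv : ∀ i j k : Fin 7, i < j → j < k →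
      det3 (hat (p i)) (hat (p j)) (hat (p k)) < 0) {i : Fin 7} (h : IsMinusCrossing p i) :
    sline p i ⬝ᵥ hat (p (i + 6)) ≤ 0 := by
  obtain ⟨ε, hε, h1, -, h0⟩ := h
  have hpos := sline_dotProduct_hat_self_pos hconv i
  have hneg := h0 i (by clear * -; revert i; decide) (by clear * -; revert i; decide)
  rw [show i - 1 = i + 6 by clear * -; revert i; decide] at h1
  obtain rfl | rfl := hε <;> linarith

/-- If `ℓ_i` is `−`-crossing, then `ℓ_{i+3}` is not `+`-crossing. -/
theorem IsMinusCrossing.not_isPlusCrossing_add_three {p : Fin 7 → Fin 2 → ℝ}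
    (hconv : ∀ i j k : Fin 7, i < j → j < k →
      det3 (hat (p i)) (hat (p j)) (hat (p k)) < 0) {i : Fin 7} (hm : IsMinusCrossing p i) :
    ¬ IsPlusCrossing p (i + 3) := by
  intro hp
  have hm' := hm.sline_dotProduct_hat_add_six_nonpos hconv
  have hp' := hp.sline_dotProduct_hat_add_one_nonpos hconv
  rw [sline_dotProduct_hat_add_six] at hm'
  rw [sline_dotProduct_hat_add_one] at hp'
  have h := det3_hat_add_neg hconv i
  have h0 := fun a b => h 0 a b
  simp only [add_zero] at h0
  simp only [add_assoc, show (3 : Fin 7) + 1 = 4 from rfl, show (3 : Fin 7) + 2 = 5 from rfl,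
    show (3 : Fin 7) + 3 = 6 from rfl, show (3 : Fin 7) + 4 = 0 from rfl,
    show (3 : Fin 7) + 5 = 1 from rfl, show (3 : Fin 7) + 6 = 2 from rfl, add_zero] at hp'
  rw [det3_rotate (hat (p i)) (hat (p (i + 4))),
    ← det3_rotate (hat (p (i + 3))) (hat (p (i + 1)))] at hp'
  have h012 := h0 1 2 (by decide) (by decide)
  have h123 := h 1 2 3 (by decide) (by decide)
  have hm'' := nonneg_of_mul_nonpos_right hm' (h0 4 6 (by decide) (by decide))
  have hp'' := nonneg_of_mul_nonpos_right hp' (h 3 4 6 (by decide) (by decide))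
  have h056 := h0 5 6 (by decide) (by decide)
  have hmul := mul_le_mul (sub_nonneg.mp hm'') (sub_nonneg.mp hp'')
    (mul_pos_of_neg_of_neg h123 (h0 4 5 (by decide) (by decide))).le
    (mul_pos_of_neg_of_neg h123 h056).le
  have hlt : 0 < det3 (hat (p (i + 4))) (hat (p (i + 5))) (hat (p (i + 6))) *
      det3 (hat (p i)) (hat (p (i + 3))) (hat (p (i + 5))) :=
    mul_pos_of_neg_of_neg (h 4 5 6 (by decide) (by decide)) (h0 3 5 (by decide) (by decide))
  have hpl := det3_plucker (hat (p i)) (hat (p (i + 3))) (hat (p (i + 4))) (hat (p (i + 5)))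
    (hat (p (i + 6)))
  have := mul_pos (mul_pos_of_neg_of_neg h012 h123) hlt
  apply lt_irrefl (0 : ℝ)
  linear_combination this + hmul -
    det3 (hat (p i)) (hat (p (i + 1))) (hat (p (i + 2))) *
      det3 (hat (p (i + 1))) (hat (p (i + 2))) (hat (p (i + 3))) * hpl

/-- If every standardization line of a heptagon is `+`-crossing or `−`-crossing, then
either all seven are `+`-crossing or all seven are `−`-crossing. -/
theorem all_crossing_same_sign
    (p : Fin 7 → Fin 2 → ℝ)
    (hconv : ∀ i j k : Fin 7, i < j → j < k →
      det3 (hat (p i)) (hat (p j)) (hat (p k)) < 0)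
    (hall : ∀ i : Fin 7, IsPlusCrossing p i ∨ IsMinusCrossing p i) :
    (∀ i : Fin 7, IsPlusCrossing p i) ∨ (∀ i : Fin 7, IsMinusCrossing p i) := by
  by_cases hplus : ∀ i, IsPlusCrossing p i
  · exact Or.inl hplus
  · right
    obtain ⟨i, hi⟩ := not_forall.mp hplus
    have step (j : Fin 7) (hj : IsMinusCrossing p j) : IsMinusCrossing p (j + 3) :=
      (hall _).resolve_left (hj.not_isPlusCrossing_add_three hconv)
    have hmul (n : ℕ) : IsMinusCrossing p (i + n • 3) := by
      induction n with
      | zero => simpa using (hall i).resolve_left hi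
      | succ n ih => simpa [succ_nsmul, add_assoc] using step _ ih
    intro j
    have hj : i + (5 * (j - i)).val • 3 = j := by
      clear * -
      revert i j
      decide
    exact hj ▸ hmul _
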